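/- arXiv:2005.04592 — 2 statements merged into one kernel-verified Lean document; each statement's English description precedes it below -/
import Mathlib

section
/- Fix P > 0 and a fixed number of relays M ∈ ℕ, M ≥ 1. For each L, let h be a standard Gaussian random vector in ℝ^L. Then for every ε > 0, lim_{L→∞} P( M · sup_{a ∈ ℤ^L, a ≠ 0} R(h,a) > ε ) = 0. Consequently, the CF system sum-rate C_SR = R·L/N, where the common message rate satisfies R ≤ min over all slots and relays of the computation rates and the completion time satisfies N ≥ L/M, converges to zero in probability as L → ∞. -/
open MeasureTheory ProbabilityTheory Filter

/-- Squared Euclidean norm of a vector in `ℝ^L`. -/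
noncomputable def sqNorm {L : ℕ} (v : Fin L → ℝ) : ℝ := ∑ i, v i ^ 2

/-- Standard inner product on `ℝ^L`. -/
noncomputable def dotp {L : ℕ} (v w : Fin L → ℝ) : ℝ := ∑ i, v i * w i

/-- The law of a standard Gaussian random vector in `ℝ^L` (i.i.d. `N(0,1)` coordinates). -/
noncomputable def gaussianPi (L : ℕ) : Measure (Fin L → ℝ) :=
  Measure.pi fun _ => gaussianReal 0 1

/-- `log⁺(x) = max(log₂ x, 0)`. -/
noncomputable def logPlus (x : ℝ) : ℝ := max (Real.logb 2 x) 0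

/-- The Compute-and-Forward computation rate
`R(h,a) = (1/2)·log⁺((‖a‖² − P⟨h,a⟩²/(1+P‖h‖²))⁻¹)`. -/
noncomputable def Rcf {L : ℕ} (P : ℝ) (h a : Fin L → ℝ) : ℝ :=
  (1 / 2) * logPlus ((sqNorm a - P * (dotp h a) ^ 2 / (1 + P * sqNorm h))⁻¹)

/-- The truncated square: `x ^ 2` if `x ^ 2 ≤ b`, and `0` otherwise. -/
noncomputable def truncSq (b x : ℝ) : ℝ := if x ^ 2 ≤ b then x ^ 2 else 0

lemma truncSq_nonneg (b x : ℝ) : 0 ≤ truncSq b x := by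
  unfold truncSq
  split_ifs <;> positivity

lemma measurable_truncSq (b : ℝ) : Measurable (truncSq b) :=
  Measurable.ite (measurableSet_le (by fun_prop) measurable_const) (by fun_prop) measurable_const

/-- The effective noise is the optimum of `‖a - β h‖² + β² / P`, attained at the MMSE scaling. -/
lemma effective_noise_eq {L : ℕ} {P : ℝ} (hP : 0 < P) (h a : Fin L → ℝ) :
    ∃ β : ℝ, sqNorm a - P * dotp h a ^ 2 / (1 + P * sqNorm h)
      = ∑ i, (a i - β * h i) ^ 2 + β ^ 2 / P := by
  have hs : 0 ≤ sqNorm h := Finset.sum_nonneg fun i _ => sq_nonneg _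
  have hpos : 0 < 1 + P * sqNorm h := by positivity
  refine ⟨P * dotp h a / (1 + P * sqNorm h), ?_⟩
  have expand : ∀ β : ℝ, ∑ i, (a i - β * h i) ^ 2
      = sqNorm a - 2 * β * dotp h a + β ^ 2 * sqNorm h := by
    intro β
    simp only [sqNorm, dotp, Finset.mul_sum, ← Finset.sum_sub_distrib, ← Finset.sum_add_distrib]
    exact Finset.sum_congr rfl fun i _ => by ring
  rw [expand]
  field_simp
  ring

lemma sq_le_sq_int_sub {x : ℝ} (hx : x ^ 2 ≤ 1 / 4) (n : ℤ) : x ^ 2 ≤ ((n : ℝ) - x) ^ 2 := by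
  obtain ⟨h1, h2⟩ := abs_le.1 (abs_le_of_sq_le_sq (by linarith : x ^ 2 ≤ (1 / 2) ^ 2) (by norm_num))
  rcases lt_trichotomy n 0 with hn | rfl | hn
  · have : (n : ℝ) ≤ -1 := by exact_mod_cast Int.le_sub_one_of_lt hn
    nlinarith
  · simp
  · have : (1 : ℝ) ≤ n := by exact_mod_cast hn
    nlinarith

lemma le_sq_of_int_sub_sq_lt {x r : ℝ} (hr : r < 1) {n : ℤ} (hn : n ≠ 0)
    (hx : ((n : ℝ) - x) ^ 2 < r) : (1 - √r) ^ 2 ≤ x ^ 2 := by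
  have hs : √r < 1 := (Real.sqrt_lt' one_pos).2 (by linarith)
  have h1 : |(n : ℝ) - x| < √r := Real.lt_sqrt_of_sq_lt (by rwa [sq_abs])
  have h2 : (1 : ℝ) ≤ |(n : ℝ)| := by exact_mod_cast Int.one_le_abs hn
  have h3 := abs_sub_abs_le_abs_sub (n : ℝ) x
  rw [← sq_abs x]
  exact pow_le_pow_left₀ (by linarith) (by linarith) 2

/-- If no coordinate of `h` dominates the truncated energy of `h`, then every nonzero integer
vector has effective noise at least `r`. -/
lemma le_effective_noise {L : ℕ} {P r : ℝ} (hP : 0 < P) (hr : r < 1) (h : Fin L → ℝ)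
    (hh : ∀ i, h i ^ 2 < (1 - √r) ^ 2 * ∑ j, truncSq (1 / (4 * P)) (h j))
    (a : Fin L → ℤ) (ha : a ≠ 0) :
    r ≤ sqNorm (fun i => (a i : ℝ)) - P * dotp h (fun i => (a i : ℝ)) ^ 2 / (1 + P * sqNorm h) := by
  obtain ⟨β, hβ⟩ := effective_noise_eq hP h fun i => (a i : ℝ)
  rw [hβ]
  by_contra! hlt
  obtain ⟨i, hi⟩ := Function.ne_iff.1 ha
  have hsum : 0 ≤ ∑ i, ((a i : ℝ) - β * h i) ^ 2 := Finset.sum_nonneg fun i _ => sq_nonneg _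
  have hβP : 0 ≤ β ^ 2 / P := by positivity
  have hβ2 : β ^ 2 ≤ P := by
    have : β ^ 2 / P ≤ 1 := by linarith
    rwa [div_le_one hP] at this
  have hi1 : ((a i : ℝ) - β * h i) ^ 2 < r :=
    (Finset.single_le_sum (f := fun i => ((a i : ℝ) - β * h i) ^ 2)
      (fun i _ => sq_nonneg _) (Finset.mem_univ i)).trans_lt (by linarith)
  have hi2 := le_sq_of_int_sub_sq_lt hr hi hi1
  have hS : β ^ 2 * ∑ j, truncSq (1 / (4 * P)) (h j) ≤ ∑ j, ((a j : ℝ) - β * h j) ^ 2 := by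
    rw [Finset.mul_sum]
    refine Finset.sum_le_sum fun j _ => ?_
    unfold truncSq
    split_ifs with hj
    · rw [← mul_pow]
      refine sq_le_sq_int_sub ?_ _
      calc (β * h j) ^ 2 = β ^ 2 * h j ^ 2 := mul_pow _ _ _
        _ ≤ P * (1 / (4 * P)) := by gcongr
        _ = 1 / 4 := by field_simp
    · simpa using sq_nonneg _
  have hS0 : 0 ≤ ∑ j, truncSq (1 / (4 * P)) (h j) :=
    Finset.sum_nonneg fun j _ => truncSq_nonneg _ _
  rw [mul_pow] at hi2
  have h1 : h i ^ 2 < β ^ 2 * h i ^ 2 * ∑ j, truncSq (1 / (4 * P)) (h j) :=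
    (hh i).trans_le (mul_le_mul_of_nonneg_right hi2 hS0)
  have h2 : h i ^ 2 * (β ^ 2 * ∑ j, truncSq (1 / (4 * P)) (h j)) ≤ h i ^ 2 * 1 :=
    mul_le_mul_of_nonneg_left (by linarith) (sq_nonneg _)
  linarith

lemma Rcf_le_of_le_effective_noise {L : ℕ} {P δ : ℝ} (hδ : 0 ≤ δ) {h a : Fin L → ℝ}
    (hq : (2 : ℝ) ^ (-(2 * δ)) ≤ sqNorm a - P * dotp h a ^ 2 / (1 + P * sqNorm h)) :
    Rcf P h a ≤ δ := by
  have h0 : (0 : ℝ) < 2 ^ (-(2 * δ)) := by positivity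
  have hlog := Real.logb_le_logb_of_le one_lt_two h0 hq
  rw [Real.logb_rpow two_pos (by norm_num)] at hlog
  have : logPlus ((sqNorm a - P * dotp h a ^ 2 / (1 + P * sqNorm h))⁻¹) ≤ 2 * δ := by
    unfold logPlus
    rw [Real.logb_inv]
    exact max_le (by linarith) (by linarith)
  unfold Rcf
  linarith

instance (L : ℕ) : IsProbabilityMeasure (gaussianPi L) := by
  unfold gaussianPi
  infer_instance

lemma integrable_exp_neg_truncSq (b : ℝ) :
    Integrable (fun x => Real.exp (-truncSq b x)) (gaussianReal 0 1) := by
  refine Integrable.of_bound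
    (Real.measurable_exp.comp (measurable_truncSq b).neg).aestronglyMeasurable 1 ?_
  filter_upwards with x
  rw [Real.norm_eq_abs, Real.abs_exp, Real.exp_le_one_iff]
  linarith [truncSq_nonneg b x]

lemma integral_exp_neg_truncSq_lt_one {b : ℝ} (hb : 0 < b) :
    ∫ x, Real.exp (-truncSq b x) ∂(gaussianReal 0 1) < 1 := by
  have hintegrable := integrable_exp_neg_truncSq b
  have hnonneg : 0 ≤ fun x => 1 - Real.exp (-truncSq b x) := fun x => by
    have : Real.exp (-truncSq b x) ≤ 1 := by
      rw [Real.exp_le_one_iff]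
      linarith [truncSq_nonneg b x]
    simpa using this
  have hpos : 0 < ∫ x, (1 - Real.exp (-truncSq b x)) ∂(gaussianReal 0 1) := by
    rw [integral_pos_iff_support_of_nonneg hnonneg ((integrable_const _).sub hintegrable)]
    have hsub : Set.Ioo 0 (√b) ⊆ Function.support fun x => 1 - Real.exp (-truncSq b x) := by
      intro x hx
      have hxb : x ^ 2 ≤ b := (Real.le_sqrt' hx.1).1 hx.2.le
      have hx2 : 0 < x ^ 2 := pow_pos hx.1 2
      have : Real.exp (-truncSq b x) < 1 := by
        rw [Real.exp_lt_one_iff, truncSq, if_pos hxb]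
        linarith
      exact (sub_pos.2 this).ne'
    refine lt_of_lt_of_le (pos_iff_ne_zero.2 fun h0 => ?_) (measure_mono hsub)
    have := gaussianReal_absolutelyContinuous' 0 (one_ne_zero) h0
    have hsqrt : √b ≤ 0 := by simpa [Real.volume_Ioo] using this
    exact (Real.sqrt_pos.2 hb).not_ge hsqrt
  rw [integral_sub (integrable_const _) hintegrable] at hpos
  simpa using hpos

/-- The truncated energy of a standard Gaussian vector grows linearly in the dimension. -/
lemma exists_tendsto_gaussianPi_sum_truncSq {b : ℝ} (hb : 0 < b) :
    ∃ c > (0 : ℝ), Tendsto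
      (fun L : ℕ => gaussianPi L {h | ∑ i, truncSq b (h i) ≤ c * L}) atTop (nhds 0) := by
  set ρ := ∫ x, Real.exp (-truncSq b x) ∂(gaussianReal 0 1) with hρ
  have hρ1 : ρ < 1 := integral_exp_neg_truncSq_lt_one hb
  have hρ0 : 0 < ρ := integral_exp_pos (integrable_exp_neg_truncSq b)
  have hlog : Real.log ρ < 0 := Real.log_neg hρ0 hρ1
  refine ⟨-Real.log ρ / 2, by linarith, ?_⟩
  have hbound : ∀ L : ℕ, (gaussianPi L).real {h | ∑ i, truncSq b (h i) ≤ -Real.log ρ / 2 * L}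
      ≤ Real.exp (Real.log ρ / 2) ^ L := by
    intro L
    have hprod : ∀ h : Fin L → ℝ, Real.exp (-∑ i, truncSq b (h i))
        = ∏ i, Real.exp (-truncSq b (h i)) := fun h => by
      rw [← Real.exp_sum, Finset.sum_neg_distrib]
    have hI : Integrable (fun h : Fin L → ℝ => Real.exp (-∑ i, truncSq b (h i)))
        (gaussianPi L) := by
      simp_rw [hprod]
      exact Integrable.fintype_prod fun _ => integrable_exp_neg_truncSq b
    have hE : ∫ h, Real.exp (-∑ i, truncSq b (h i)) ∂(gaussianPi L) = ρ ^ L := by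
      simp_rw [hprod, gaussianPi]
      rw [integral_fintype_prod_eq_pow (ι := Fin L) (fun x => Real.exp (-truncSq b x))]
      simp [hρ]
    have hM := mul_meas_ge_le_integral_of_nonneg
      (Eventually.of_forall fun h => (Real.exp_pos _).le) hI (Real.exp (Real.log ρ / 2 * L))
    have hset : {h : Fin L → ℝ | ∑ i, truncSq b (h i) ≤ -Real.log ρ / 2 * L}
        = {h | Real.exp (Real.log ρ / 2 * L) ≤ Real.exp (-∑ i, truncSq b (h i))} := by
      ext h
      simp only [Set.mem_ofPred_eq, Real.exp_le_exp]
      constructor <;> intro <;> linarith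
    rw [hE, ← hset] at hM
    have hρL : ρ ^ L = Real.exp (Real.log ρ / 2 * L) * Real.exp (Real.log ρ / 2) ^ L := by
      rw [← Real.exp_nat_mul, ← Real.exp_add, ← Real.exp_log (pow_pos hρ0 L), Real.log_pow]
      congr 1
      ring
    rw [hρL] at hM
    exact le_of_mul_le_mul_left hM (Real.exp_pos _)
  rw [← ENNReal.tendsto_toReal_iff (fun L => measure_ne_top _ _) ENNReal.zero_ne_top]
  exact squeeze_zero (fun _ => ENNReal.toReal_nonneg) hbound
    (tendsto_pow_atTop_nhds_zero_of_lt_one (Real.exp_pos _).le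
      (Real.exp_lt_one_iff.2 (by linarith)))

/-- No coordinate of a standard Gaussian vector has squared size linear in the dimension. -/
lemma tendsto_gaussianPi_exists_sq_ge {c : ℝ} (hc : 0 < c) :
    Tendsto (fun L : ℕ => gaussianPi L {h | ∃ i, c * L ≤ h i ^ 2}) atTop (nhds 0) := by
  have hintegrable : Integrable (fun x : ℝ => x ^ 4) (gaussianReal 0 1) := by
    have := (memLp_id_gaussianReal (μ := 0) (v := 1) 4).integrable_norm_pow (p := 4) (by norm_num)
    refine this.congr (Eventually.of_forall fun x => ?_)
    simp [Even.pow_abs (by decide : Even 4)]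
  set K := ∫ x, x ^ 4 ∂(gaussianReal 0 1)
  have hone : ∀ L : ℕ, 0 < L → (gaussianReal 0 1).real {x | c * L ≤ x ^ 2} ≤ K / (c * L) ^ 2 := by
    intro L hL
    have hL' : (0 : ℝ) < L := by exact_mod_cast hL
    have hM := mul_meas_ge_le_integral_of_nonneg
      (Eventually.of_forall fun x : ℝ => by positivity) hintegrable ((c * L) ^ 2)
    rw [le_div_iff₀' (by positivity)]
    refine le_trans (mul_le_mul_of_nonneg_left (measureReal_mono fun x hx => ?_)
      (sq_nonneg _)) hM
    have : (c * L) ^ 2 ≤ (x ^ 2) ^ 2 := pow_le_pow_left₀ (by positivity) hx 2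
    calc (c * L) ^ 2 ≤ (x ^ 2) ^ 2 := this
      _ = x ^ 4 := by ring
  have hbound : ∀ᶠ L : ℕ in atTop,
      (gaussianPi L).real {h | ∃ i, c * L ≤ h i ^ 2} ≤ K / c ^ 2 * (L : ℝ)⁻¹ := by
    filter_upwards [eventually_gt_atTop 0] with L hL
    have hL' : (0 : ℝ) < L := by exact_mod_cast hL
    have hmeas : MeasurableSet {x : ℝ | c * L ≤ x ^ 2} :=
      measurableSet_le measurable_const (by fun_prop)
    have heval : ∀ i : Fin L, (gaussianPi L).real {h | c * L ≤ h i ^ 2}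
        = (gaussianReal 0 1).real {x | c * L ≤ x ^ 2} := fun i =>
      (measurePreserving_eval (fun _ : Fin L => gaussianReal 0 1) i).measureReal_preimage hmeas.nullMeasurableSet
    rw [Set.ofPred_exists]
    calc (gaussianPi L).real (⋃ i, {h | c * L ≤ h i ^ 2})
        ≤ ∑ i : Fin L, (gaussianPi L).real {h | c * L ≤ h i ^ 2} := measureReal_iUnion_fintype_le _
      _ = L * (gaussianReal 0 1).real {x | c * L ≤ x ^ 2} := by simp [heval]
      _ ≤ L * (K / (c * L) ^ 2) := by gcongr; exact hone L hL
      _ = K / c ^ 2 * (L : ℝ)⁻¹ := by field_simp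
  rw [← ENNReal.tendsto_toReal_iff (fun L => measure_ne_top _ _) ENNReal.zero_ne_top]
  refine squeeze_zero' (Eventually.of_forall fun _ => ENNReal.toReal_nonneg) hbound ?_
  simpa using (tendsto_inv_atTop_nhds_zero_nat (𝕜 := ℝ)).const_mul (K / c ^ 2)

/-- The best computation rate over all nonzero integer vectors tends to zero in probability. -/
lemma tendsto_gaussianPi_iSup_Rcf {P : ℝ} (hP : 0 < P) {δ : ℝ} (hδ : 0 < δ) :
    Tendsto (fun L : ℕ => gaussianPi L
      {h | δ < ⨆ a : {a : Fin L → ℤ // a ≠ 0}, Rcf P h fun i => (a.1 i : ℝ)}) atTop (nhds 0) := by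
  obtain ⟨c, hc, hS⟩ := exists_tendsto_gaussianPi_sum_truncSq (b := 1 / (4 * P)) (by positivity)
  set r : ℝ := 2 ^ (-(2 * δ))
  have hr : r < 1 := Real.rpow_lt_one_of_one_lt_of_neg one_lt_two (by linarith)
  have hd : 0 < (1 - √r) ^ 2 :=
    pow_pos (sub_pos.2 ((Real.sqrt_lt' one_pos).2 (by linarith))) 2
  have hlim := hS.add (tendsto_gaussianPi_exists_sq_ge (mul_pos hd hc))
  rw [add_zero] at hlim
  refine tendsto_of_tendsto_of_tendsto_of_le_of_le tendsto_const_nhds hlim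
    (fun _ => zero_le) fun L => (measure_mono fun h hh => ?_).trans (measure_union_le _ _)
  by_contra hbad
  simp only [Set.mem_union, Set.mem_ofPred_eq, not_or, not_le, not_exists] at hbad
  obtain ⟨hsum, hmax⟩ := hbad
  refine (not_lt.2 (Real.iSup_le (fun a => ?_) hδ.le)) hh
  refine Rcf_le_of_le_effective_noise hδ.le (le_effective_noise hP hr h (fun i => ?_) a.1 a.2)
  calc h i ^ 2 < (1 - √r) ^ 2 * c * L := hmax i
    _ = (1 - √r) ^ 2 * (c * L) := by ring
    _ ≤ _ := by gcongr

/-- With a fixed number `M ≥ 1` of relays: (i) `M` times the best computation rate over all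
nonzero integer coefficient vectors tends to zero in probability as `L → ∞`; consequently
(ii) any CF system sum-rate `C_SR = R·L/N`, where the common message rate `R` is at most the
best computation rate and the completion time satisfies `N ≥ L/M`, converges to zero in
probability as `L → ∞`. -/
theorem statement4 (P : ℝ) (hP : 0 < P) (M : ℕ) (hM : 1 ≤ M) :
    (∀ ε > (0 : ℝ),
      Tendsto (fun L : ℕ =>
          gaussianPi L {h | ε < (M : ℝ) *
            ⨆ a : {a : Fin L → ℤ // a ≠ 0}, Rcf P h fun i => (a.1 i : ℝ)})
        atTop (nhds 0))
    ∧ ∀ (R N : (L : ℕ) → (Fin L → ℝ) → ℝ),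
        (∀ (L : ℕ) (h : Fin L → ℝ), R L h ≤ ⨆ a : {a : Fin L → ℤ // a ≠ 0}, Rcf P h fun i => (a.1 i : ℝ)) →
        (∀ (L : ℕ) (h : Fin L → ℝ), 0 ≤ R L h) →
        (∀ (L : ℕ) (h : Fin L → ℝ), (L : ℝ) / (M : ℝ) ≤ N L h) →
        ∀ ε > (0 : ℝ),
          Tendsto (fun L : ℕ =>
              gaussianPi L {h | ε < R L h * (L : ℝ) / N L h})
            atTop (nhds 0) := by
  have hM0 : (0 : ℝ) < M := by exact_mod_cast hM
  have rate : ∀ ε > (0 : ℝ),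
      Tendsto (fun L : ℕ =>
          gaussianPi L {h | ε < (M : ℝ) *
            ⨆ a : {a : Fin L → ℤ // a ≠ 0}, Rcf P h fun i => (a.1 i : ℝ)})
        atTop (nhds 0) := by
    intro ε hε
    simpa only [div_lt_iff₀' hM0] using tendsto_gaussianPi_iSup_Rcf hP (div_pos hε hM0)
  refine ⟨rate, fun R N hR hR0 hN ε hε => ?_⟩
  refine tendsto_of_tendsto_of_tendsto_of_le_of_le tendsto_const_nhds (rate ε hε)
    (fun _ => zero_le) fun L => measure_mono fun h (hh : ε < _) => hh.trans_le ?_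
  rcases Nat.eq_zero_or_pos L with rfl | hL
  · simp only [Nat.cast_zero, mul_zero, zero_div] at hh
    exact absurd hh hε.not_gt
  · have hL0 : (0 : ℝ) < L := by exact_mod_cast hL
    have hLM : (0 : ℝ) < L / M := by positivity
    calc R L h * L / N L h ≤ R L h * L / (L / M) :=
          div_le_div_of_nonneg_left (mul_nonneg (hR0 L h) hL0.le) hLM (hN L h)
      _ = M * R L h := by field_simp
      _ ≤ _ := mul_le_mul_of_nonneg_left (hR L h) hM0.le
end

section
/- Fix P > 0. For each L, set δ_L = 1/ln L, u_L = √(2·ln(δ_L√L/√(2π))) − δ_L, k_L = ⌈ln L⌉ + 1, p_L = 2(Φ(u_L+δ_L) − Φ(u_L)) with Φ the standard normal CDF, and g_L = exp( −(L·p_L − (k_L−1))² / (2·p_L·L) ). Then lim_{L→∞} [ −2·log₂( k_L·( 1 − P·k_L·u_L⁴·(1−g_L)^L / ((u_L+δ_L)²·(1 + P·k_L·u_L²)) ) ) ] / log₂ log₂ L = 1. That is, the lower bound on the expected per-slot rate achieved by the scheduling algorithm scales exactly as (1/4)·log log L. -/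
open MeasureTheory ProbabilityTheory Filter

/-- The standard normal cumulative distribution function `Φ`. -/
noncomputable def stdNormalCDF (x : ℝ) : ℝ :=
  ∫ t in Set.Iic x, gaussianPDFReal 0 1 t

/-- `δ_L = 1/ln L`. -/
noncomputable def deltaL (L : ℕ) : ℝ := 1 / Real.log L

/-- `u_L = √(2·ln(δ_L√L/√(2π))) − δ_L`. -/
noncomputable def uL (L : ℕ) : ℝ :=
  Real.sqrt (2 * Real.log (deltaL L * Real.sqrt L / Real.sqrt (2 * Real.pi))) - deltaL L

/-- `k_L = ⌈ln L⌉ + 1`. -/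
noncomputable def kL (L : ℕ) : ℕ := ⌈Real.log L⌉₊ + 1

/-- `p_L = 2(Φ(u_L+δ_L) − Φ(u_L))`. -/
noncomputable def pL (L : ℕ) : ℝ :=
  2 * (stdNormalCDF (uL L + deltaL L) - stdNormalCDF (uL L))

/-- `g_L = exp(−(L·p_L − (k_L−1))²/(2·p_L·L))` (the Chernoff bound term). -/
noncomputable def gL (L : ℕ) : ℝ :=
  Real.exp (-((L : ℝ) * pL L - ((kL L : ℝ) - 1)) ^ 2 / (2 * pL L * L))

lemma tendsto_log_natCast : Tendsto (fun L : ℕ => Real.log L) atTop atTop :=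
  Real.tendsto_log_atTop.comp tendsto_natCast_atTop_atTop

lemma uL_add_deltaL (L : ℕ) : uL L + deltaL L =
    Real.sqrt (2 * Real.log (deltaL L * Real.sqrt L / Real.sqrt (2 * Real.pi))) := by
  unfold uL; ring

lemma two_mul_log_deltaL {L : ℕ} (hx : 0 < Real.log L) :
    2 * Real.log (deltaL L * Real.sqrt L / Real.sqrt (2 * Real.pi)) =
      Real.log L - 2 * Real.log (Real.log L) - Real.log (2 * Real.pi) := by
  have hL : (0 : ℝ) < L := by
    rcases Nat.eq_zero_or_pos L with h | h
    · simp [h] at hx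
    · exact_mod_cast h
  have hpi : 0 < 2 * Real.pi := by positivity
  have h1 : deltaL L ≠ 0 := by unfold deltaL; positivity
  rw [Real.log_div (by positivity) (by positivity), Real.log_mul h1 (by positivity),
    Real.log_sqrt hL.le, Real.log_sqrt hpi.le]
  unfold deltaL
  rw [one_div, Real.log_inv]
  ring

lemma tendsto_log_deltaL_div :
    Tendsto (fun L : ℕ => 2 * Real.log (deltaL L * Real.sqrt L / Real.sqrt (2 * Real.pi)) /
      Real.log L) atTop (nhds 1) := by
  have h1 : Tendsto (fun x : ℝ => 1 - 2 * (Real.log x / x) - Real.log (2 * Real.pi) / x)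
      atTop (nhds (1 - 2 * 0 - 0)) := by
    refine (tendsto_const_nhds.sub (Tendsto.const_mul _ ?_)).sub
      (tendsto_const_nhds.div_atTop tendsto_id)
    exact Real.isLittleO_log_id_atTop.tendsto_div_nhds_zero
  have h2 := h1.comp tendsto_log_natCast
  norm_num at h2
  refine h2.congr' ?_
  filter_upwards [tendsto_log_natCast.eventually_gt_atTop 0] with L hL
  rw [two_mul_log_deltaL hL]
  simp only [Function.comp]
  field_simp

lemma tendsto_uL_add_deltaL_div :
    Tendsto (fun L : ℕ => (uL L + deltaL L) / Real.sqrt (Real.log L)) atTop (nhds 1) := by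
  have h := tendsto_log_deltaL_div.sqrt
  rw [Real.sqrt_one] at h
  refine h.congr' ?_
  filter_upwards [tendsto_log_natCast.eventually_gt_atTop 0] with L hL
  rw [uL_add_deltaL, Real.sqrt_div' _ hL.le]

lemma tendsto_sqrt_log : Tendsto (fun L : ℕ => Real.sqrt (Real.log L)) atTop atTop :=
  Real.tendsto_sqrt_atTop.comp tendsto_log_natCast

lemma tendsto_deltaL : Tendsto deltaL atTop (nhds 0) :=
  tendsto_const_nhds.div_atTop tendsto_log_natCast

lemma tendsto_uL_div :
    Tendsto (fun L : ℕ => uL L / Real.sqrt (Real.log L)) atTop (nhds 1) := by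
  have h := tendsto_uL_add_deltaL_div.sub (tendsto_deltaL.div_atTop tendsto_sqrt_log)
  rw [sub_zero] at h
  exact h.congr fun L => by ring

lemma tendsto_kL_div : Tendsto (fun L : ℕ => (kL L : ℝ) / Real.log L) atTop (nhds 1) := by
  have h := ((tendsto_nat_ceil_div_atTop (R := ℝ)).comp tendsto_log_natCast).add
    ((tendsto_const_nhds (x := (1 : ℝ))).div_atTop tendsto_log_natCast)
  rw [add_zero] at h
  refine h.congr fun L => ?_
  simp only [kL, Function.comp]
  push_cast
  ring

lemma stdNormalCDF_sub (a b : ℝ) :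
    stdNormalCDF b - stdNormalCDF a = ∫ t in a..b, gaussianPDFReal 0 1 t :=
  intervalIntegral.integral_Iic_sub_Iic (integrable_gaussianPDFReal 0 1).integrableOn
    (integrable_gaussianPDFReal 0 1).integrableOn

lemma mul_gaussianPDFReal_le_stdNormalCDF_sub {a b : ℝ} (ha : 0 ≤ a) (hab : a ≤ b) :
    (b - a) * gaussianPDFReal 0 1 b ≤ stdNormalCDF b - stdNormalCDF a := by
  rw [stdNormalCDF_sub, ← smul_eq_mul, ← intervalIntegral.integral_const]
  refine intervalIntegral.integral_mono_on hab (by simp)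
    (integrable_gaussianPDFReal 0 1).intervalIntegrable fun t ht => ?_
  unfold gaussianPDFReal
  have : 0 ≤ t := ha.trans ht.1
  gcongr
  simpa using ht.2

lemma eventually_two_div_sqrt_le_pL : ∀ᶠ L : ℕ in atTop, 2 / Real.sqrt L ≤ pL L := by
  have hlog := tendsto_log_deltaL_div.eventually_const_lt zero_lt_one
  have hu := tendsto_uL_div.eventually_const_lt zero_lt_one
  filter_upwards [hlog, hu, tendsto_log_natCast.eventually_gt_atTop 0,
    eventually_gt_atTop 0] with L h1 h2 hx hL
  have hL' : (0 : ℝ) < L := by exact_mod_cast hL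
  have hs : 0 < 2 * Real.log (deltaL L * Real.sqrt L / Real.sqrt (2 * Real.pi)) := by
    rwa [div_pos_iff_of_pos_right hx] at h1
  have hu0 : 0 < uL L := by
    rwa [div_pos_iff_of_pos_right (by positivity)] at h2
  have hd : 0 < deltaL L := by unfold deltaL; positivity
  have hpi := Real.pi_pos
  have key := mul_gaussianPDFReal_le_stdNormalCDF_sub hu0.le
    (le_add_of_nonneg_right hd.le : uL L ≤ uL L + deltaL L)
  have hpdf : gaussianPDFReal 0 1 (uL L + deltaL L) = 1 / (deltaL L * Real.sqrt L) := by
    rw [gaussianPDFReal, uL_add_deltaL, sub_zero, Real.sq_sqrt hs.le]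
    have : -(2 * Real.log (deltaL L * Real.sqrt L / Real.sqrt (2 * Real.pi))) /
        (2 * ((1 : NNReal) : ℝ)) =
        -Real.log (deltaL L * Real.sqrt L / Real.sqrt (2 * Real.pi)) := by
      rw [NNReal.coe_one]; ring
    rw [this, Real.exp_neg, Real.exp_log (by positivity)]
    simp only [NNReal.coe_one, mul_one]
    field_simp
  rw [hpdf] at key
  unfold pL
  calc 2 / Real.sqrt L = 2 * ((uL L + deltaL L - uL L) * (1 / (deltaL L * Real.sqrt L))) := by
        rw [add_sub_cancel_left]; field_simp
    _ ≤ _ := by gcongr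

lemma gL_le_one {L : ℕ} (hp : 0 ≤ pL L) : gL L ≤ 1 := by
  unfold gL
  rw [Real.exp_le_one_iff, neg_div, neg_nonpos]
  positivity

lemma eventually_kL_sub_one_le_sqrt : ∀ᶠ L : ℕ in atTop, (kL L : ℝ) - 1 ≤ Real.sqrt L := by
  have h : Tendsto (fun x : ℝ => Real.log x / x ^ (1 / 2 : ℝ)) atTop (nhds 0) :=
    (isLittleO_log_rpow_atTop (by norm_num)).tendsto_div_nhds_zero
  have h' := (h.comp tendsto_natCast_atTop_atTop).eventually_lt_const
    (u := 1 / 2) (by norm_num)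
  have hk := tendsto_kL_div.eventually_lt_const one_lt_two
  filter_upwards [h', hk, tendsto_log_natCast.eventually_gt_atTop 0,
    eventually_gt_atTop 0] with L h1 h2 hx hL
  have hL' : (0 : ℝ) < L := by exact_mod_cast hL
  simp only [Function.comp, ← Real.sqrt_eq_rpow] at h1
  rw [div_lt_iff₀ (by positivity)] at h1 h2
  linarith

lemma eventually_gL_le : ∀ᶠ L : ℕ in atTop, gL L ≤ Real.exp (-(Real.sqrt L / 4)) := by
  filter_upwards [eventually_two_div_sqrt_le_pL, eventually_kL_sub_one_le_sqrt,
    eventually_gt_atTop 0] with L hp hk hL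
  have hL' : (0 : ℝ) < L := by exact_mod_cast hL
  have hr : 0 < Real.sqrt L := by positivity
  have hp0 : 0 < pL L := lt_of_lt_of_le (by positivity) hp
  have h1 : 2 * Real.sqrt L ≤ L * pL L := by
    rw [div_le_iff₀ hr] at hp
    nlinarith [Real.mul_self_sqrt hL'.le]
  unfold gL
  rw [Real.exp_le_exp, neg_div, neg_le_neg_iff, le_div_iff₀ (by positivity)]
  nlinarith

lemma tendsto_mul_one_sub_pow_gL :
    Tendsto (fun L : ℕ => (kL L : ℝ) * Real.sqrt (Real.log L) * (1 - (1 - gL L) ^ L))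
      atTop (nhds 0) := by
  have hsq : Tendsto (fun L : ℕ => Real.sqrt L / 4) atTop atTop :=
    (Real.tendsto_sqrt_atTop.comp tendsto_natCast_atTop_atTop).atTop_div_const (by norm_num)
  have h6 := ((Real.tendsto_pow_mul_exp_neg_atTop_nhds_zero 6).comp hsq).const_mul ((4 : ℝ) ^ 6)
  have hmaj := tendsto_kL_div.mul h6
  simp only [mul_zero] at hmaj
  refine tendsto_of_tendsto_of_tendsto_of_le_of_le' tendsto_const_nhds hmaj ?_ ?_
  · filter_upwards [eventually_two_div_sqrt_le_pL] with L hp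
    have hg := gL_le_one (le_trans (by positivity) hp)
    have hg0 : 0 < gL L := Real.exp_pos _
    have := pow_le_one₀ (n := L) (by linarith : 0 ≤ 1 - gL L) (by linarith)
    exact mul_nonneg (by positivity) (by linarith)
  · filter_upwards [eventually_two_div_sqrt_le_pL, eventually_gL_le,
      tendsto_log_natCast.eventually_ge_atTop 1] with L hp hle hx
    have hg := gL_le_one (le_trans (by positivity) hp)
    have hx0 : 0 < Real.log L := by linarith
    have hb := one_add_mul_le_pow (a := -gL L) (by linarith) L
    rw [← sub_eq_add_neg] at hb
    have hL6 : (4 : ℝ) ^ 6 * (Real.sqrt L / 4) ^ 6 = (L : ℝ) * L * L := by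
      have : (Real.sqrt L) ^ 6 = ((Real.sqrt L) ^ 2) ^ 3 := by ring
      rw [div_pow, this, Real.sq_sqrt (by positivity)]
      ring
    have hlog : Real.log L ≤ L := Real.log_le_self (by positivity)
    have hsl : Real.sqrt (Real.log L) ≤ L :=
      (Real.sqrt_le_iff.2 ⟨hx0.le, by nlinarith⟩).trans hlog
    simp only [Function.comp]
    calc (kL L : ℝ) * Real.sqrt (Real.log L) * (1 - (1 - gL L) ^ L)
        ≤ (kL L : ℝ) * Real.sqrt (Real.log L) * (L * Real.exp (-(Real.sqrt L / 4))) := by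
          gcongr
          nlinarith [mul_le_mul_of_nonneg_left hle (Nat.cast_nonneg (α := ℝ) L)]
      _ = (kL L : ℝ) / Real.log L * (Real.log L * Real.sqrt (Real.log L) *
            L * Real.exp (-(Real.sqrt L / 4))) := by field_simp
      _ ≤ (kL L : ℝ) / Real.log L * (L * L * L * Real.exp (-(Real.sqrt L / 4))) := by
          gcongr
      _ = _ := by rw [← hL6]; ring

/-- The quantity under the logarithm in the rate bound decays like `2 / √(ln L)`. -/
lemma tendsto_rate_argument_mul_sqrt_log {P : ℝ} (hP : 0 < P) :
    Tendsto (fun L : ℕ => (kL L : ℝ) *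
        (1 - P * (kL L : ℝ) * uL L ^ 4 * (1 - gL L) ^ L /
          ((uL L + deltaL L) ^ 2 * (1 + P * (kL L : ℝ) * uL L ^ 2))) *
        Real.sqrt (Real.log L)) atTop (nhds 2) := by
  have hS := tendsto_uL_add_deltaL_div
  have hU := tendsto_uL_div
  have hK := tendsto_kL_div
  have hInv : Tendsto (fun L : ℕ => (Real.sqrt (Real.log L))⁻¹) atTop (nhds 0) :=
    tendsto_inv_atTop_zero.comp tendsto_sqrt_log
  have hB : Tendsto (fun L : ℕ => (uL L / Real.sqrt (Real.log L)) ^ 2 /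
      ((uL L + deltaL L) / Real.sqrt (Real.log L)) ^ 2) atTop (nhds 1) := by
    simpa [Pi.div_def] using (hU.pow 2).div (hS.pow 2) (by norm_num)
  have hK4 : Tendsto (fun L : ℕ => (kL L : ℝ) / Real.log L *
      (uL L / Real.sqrt (Real.log L)) ^ 2 * P) atTop (nhds P) := by
    simpa using (hK.mul (hU.pow 2)).mul_const P
  have hD : Tendsto (fun L : ℕ => (Real.sqrt (Real.log L))⁻¹ ^ 4 +
      (kL L : ℝ) / Real.log L * (uL L / Real.sqrt (Real.log L)) ^ 2 * P) atTop (nhds P) := by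
    simpa using (hInv.pow 4).add hK4
  have hA : Tendsto (fun L : ℕ => (kL L : ℝ) / Real.log L *
      (uL L / Real.sqrt (Real.log L)) ^ 2 * P / ((Real.sqrt (Real.log L))⁻¹ ^ 4 +
      (kL L : ℝ) / Real.log L * (uL L / Real.sqrt (Real.log L)) ^ 2 * P))
      atTop (nhds 1) := by
    simpa [hP.ne', Pi.div_def] using hK4.div hD hP.ne'
  have h1 : Tendsto (fun L : ℕ => (kL L : ℝ) / Real.log L *
      (2 / ((uL L + deltaL L) / Real.sqrt (Real.log L)) -
        (Real.sqrt (Real.log L))⁻¹ ^ 3 / ((uL L + deltaL L) / Real.sqrt (Real.log L)) ^ 2))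
      atTop (nhds 2) := by
    simpa using hK.mul (((tendsto_const_nhds (x := (2 : ℝ))).div hS one_ne_zero).sub
      ((hInv.pow 3).div (hS.pow 2) (by norm_num)))
  have h2 : Tendsto (fun L : ℕ => (uL L / Real.sqrt (Real.log L)) ^ 2 /
      ((uL L + deltaL L) / Real.sqrt (Real.log L)) ^ 2 *
      ((kL L : ℝ) / Real.log L * (Real.sqrt (Real.log L))⁻¹ /
      ((Real.sqrt (Real.log L))⁻¹ ^ 4 +
      (kL L : ℝ) / Real.log L * (uL L / Real.sqrt (Real.log L)) ^ 2 * P)))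
      atTop (nhds 0) := by
    simpa using hB.mul ((hK.mul hInv).div hD hP.ne')
  have h3 := (hB.mul hA).mul tendsto_mul_one_sub_pow_gL
  have htot := (h1.add h2).add h3
  simp only [mul_zero, add_zero] at htot
  refine htot.congr' ?_
  filter_upwards [hS.eventually_const_lt zero_lt_one,
    tendsto_log_natCast.eventually_gt_atTop 0] with L hs hx
  have hr : 0 < Real.sqrt (Real.log L) := by positivity
  rw [div_pos_iff_of_pos_right hr] at hs
  have hd : deltaL L = 1 / (Real.sqrt (Real.log L)) ^ 2 := by
    rw [Real.sq_sqrt hx.le]; rfl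
  have hlog : Real.log L = (Real.sqrt (Real.log L)) ^ 2 := (Real.sq_sqrt hx.le).symm
  have hk : (0 : ℝ) < kL L := by unfold kL; positivity
  generalize (1 - gL L) ^ L = q
  generalize hrr : Real.sqrt (Real.log L) = r at *
  rw [hlog]
  generalize (kL L : ℝ) = k at *
  obtain ⟨s, hsdef⟩ : ∃ s, s = uL L + deltaL L := ⟨_, rfl⟩
  have hu : uL L = s - 1 / r ^ 2 := by rw [hsdef, hd]; ring
  rw [← hsdef] at hs ⊢
  have hD0 : 0 < 1 + P * k * uL L ^ 2 := by positivity
  have hE : r⁻¹ ^ 4 + k / r ^ 2 * (uL L / r) ^ 2 * P = (1 + P * k * uL L ^ 2) / r ^ 4 := by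
    field_simp
  rw [hE]
  have e1 : k / r ^ 2 * (2 / (s / r) - r⁻¹ ^ 3 / (s / r) ^ 2) =
      k * r * (1 - uL L ^ 2 / s ^ 2) := by
    rw [hu]; field_simp; ring
  rw [e1]
  field_simp
  ring

/-- The lower bound on the expected per-slot rate achieved by the scheduling algorithm,
`−2·log₂(k_L(1 − P·k_L·u_L⁴(1−g_L)^L/((u_L+δ_L)²(1+P·k_L·u_L²))))` (which is four times
the rate bound), scales exactly as `log₂ log₂ L`; i.e. the rate bound scales as
`(1/4)·log log L`. -/
theorem statement19 (P : ℝ) (hP : 0 < P) :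
    Tendsto (fun L : ℕ =>
        (-2 * Real.logb 2 ((kL L : ℝ) *
            (1 - P * (kL L : ℝ) * uL L ^ 4 * (1 - gL L) ^ L /
              ((uL L + deltaL L) ^ 2 * (1 + P * (kL L : ℝ) * uL L ^ 2)))))
          / Real.logb 2 (Real.logb 2 L))
      atTop (nhds 1) := by
  have hf := tendsto_rate_argument_mul_sqrt_log hP
  generalize hF : (fun L : ℕ => (kL L : ℝ) *
    (1 - P * (kL L : ℝ) * uL L ^ 4 * (1 - gL L) ^ L /
      ((uL L + deltaL L) ^ 2 * (1 + P * (kL L : ℝ) * uL L ^ 2)))) = F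
  have hF' := fun L => congrFun hF L
  simp only [hF'] at hf ⊢
  have hLL : Tendsto (fun L : ℕ => Real.log (Real.log L)) atTop atTop :=
    Real.tendsto_log_atTop.comp tendsto_log_natCast
  have hlogf := ((Real.continuousAt_log two_ne_zero).tendsto.comp hf).div_atTop hLL
  have hc : Tendsto (fun L : ℕ => 1 - Real.log (Real.log 2) / Real.log (Real.log L))
      atTop (nhds 1) := by
    simpa using tendsto_const_nhds.sub (tendsto_const_nhds.div_atTop hLL)
  have hlim := ((hlogf.const_mul (-2)).add_const 1).div hc one_ne_zero
  norm_num at hlim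
  refine hlim.congr' ?_
  have hl2 : 0 < Real.log 2 := Real.log_pos one_lt_two
  filter_upwards [hf.eventually_const_lt zero_lt_two,
    tendsto_log_natCast.eventually_gt_atTop 0, hLL.eventually_gt_atTop 0,
    hLL.eventually_gt_atTop (Real.log (Real.log 2))] with L h1 hx hlx hlx2
  have hr : 0 < Real.sqrt (Real.log L) := by positivity
  have hFpos : 0 < F L := (pos_iff_pos_of_mul_pos h1).2 hr
  have hne : Real.log (Real.log L) - Real.log (Real.log 2) ≠ 0 := by linarith
  simp only [Pi.div_apply, Real.logb]
  rw [Real.log_mul hFpos.ne' hr.ne', Real.log_sqrt hx.le, Real.log_div hx.ne' hl2.ne']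
  field_simp
  ring
end
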